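/- Fix α ∈ (0,1], t > 0 and q ≥ 1. Let (Ω,F,P) be a probability space, let T be a countable index set, and for each φ ∈ T let g_φ : Ω × [0,t] → ℝ be a jointly measurable random function whose sample paths lie in C^{1,α}([0,t]) almost surely. For ε > 0 set Ω_{φ,ε} = { ‖g_φ‖_{L^∞} ≤ ε and ‖g_φ'‖_{L^∞} ≥ ε^{α/(2(1+α))} } and Ω_ε = ∪_{φ∈T} Ω_{φ,ε}. Then there exists ε₀ = ε₀(α,t) > 0, namely ε₀ = (t/4)^{2(1+α)/(2+α)}, such that for every ε < ε₀, P(Ω_ε) ≤ 4^{2q(1+α)/α} ε^q E( sup_{φ∈T} ‖g_φ‖_{C^{1,α}}^{2q/α} ). -/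

import Mathlib

open Set MeasureTheory
open scoped ENNReal

/-- The sup norm `‖g‖_{L^∞}` of `g : ℝ → ℝ` over the interval `[0,t]`. -/
noncomputable def supNormIcc (t : ℝ) (g : ℝ → ℝ) : ℝ :=
  ⨆ s : Icc (0 : ℝ) t, |g s|

/-- The `α`-Hölder seminorm of `g : ℝ → ℝ` over the interval `[0,t]`
(the diagonal terms `s = r` contribute `0/0 = 0` and hence do not affect the value). -/
noncomputable def holderSeminormIcc (t α : ℝ) (g : ℝ → ℝ) : ℝ :=
  ⨆ p : Icc (0 : ℝ) t × Icc (0 : ℝ) t, |g p.1 - g p.2| / |(p.1 : ℝ) - (p.2 : ℝ)| ^ α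

open Filter Topology

/-- If `f` has an `α`-Hölder derivative with constant `K` on `[0,t]` and `|f| ≤ ε` there, then
the size of `f'` at any point is controlled by averaging over an interval of length `ℓ`. -/
lemma sub_holder_mul_le_two_mul {t α K M ε ℓ s₀ : ℝ} {f f' : ℝ → ℝ} (hα : 0 < α) (hK : 0 ≤ K)
    (hf : ∀ s ∈ Icc (0 : ℝ) t, HasDerivWithinAt f (f' s) (Icc (0 : ℝ) t) s)
    (hfε : ∀ s ∈ Icc (0 : ℝ) t, |f s| ≤ ε)
    (hf' : ∀ s ∈ Icc (0 : ℝ) t, ∀ r ∈ Icc (0 : ℝ) t, |f' s - f' r| ≤ K * |s - r| ^ α)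
    (hs₀ : s₀ ∈ Icc (0 : ℝ) t) (hM : M ≤ |f' s₀|) (hℓ : 0 < ℓ) (hℓt : ℓ ≤ t) :
    (M - K * ℓ ^ α) * ℓ ≤ 2 * ε := by
  obtain ⟨a, ha0, hbt, has, hsb⟩ : ∃ a : ℝ, 0 ≤ a ∧ a + ℓ ≤ t ∧ a ≤ s₀ ∧ s₀ ≤ a + ℓ := by
    rcases le_total (s₀ - ℓ) 0 with h | h
    · exact ⟨0, le_rfl, by linarith, hs₀.1, by linarith⟩
    · exact ⟨s₀ - ℓ, h, by linarith [hs₀.2], by linarith, by linarith⟩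
  have hsub : Icc a (a + ℓ) ⊆ Icc 0 t := Icc_subset_Icc ha0 hbt
  obtain ⟨c, hc, hslope⟩ := exists_hasDerivAt_eq_slope f f' (lt_add_of_pos_right a hℓ)
    (fun s hs => (hf s (hsub hs)).continuousWithinAt.mono hsub)
    (fun s hs => (hf s (hsub (Ioo_subset_Icc_self hs))).hasDerivAt
      (Icc_mem_nhds (ha0.trans_lt hs.1) (hs.2.trans_le hbt)))
  have hcI := hsub (Ioo_subset_Icc_self hc)
  have hdist : |s₀ - c| ≤ ℓ := abs_le.2 ⟨by linarith [hc.2], by linarith [hc.1]⟩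
  have hlow : M - K * ℓ ^ α ≤ |f' c| := by
    have h1 := hf' s₀ hs₀ c hcI
    have h2 : K * |s₀ - c| ^ α ≤ K * ℓ ^ α := by gcongr
    have h3 := abs_sub_abs_le_abs_sub (f' s₀) (f' c)
    linarith
  have hinc : |f' c| * ℓ = |f (a + ℓ) - f a| := by
    rw [hslope, add_sub_cancel_left, abs_div, abs_of_pos hℓ, div_mul_cancel₀ _ hℓ.ne']
  have h1 := hfε (a + ℓ) ⟨by linarith, hbt⟩
  have h2 := hfε a ⟨ha0, by linarith⟩
  have h3 := abs_sub (f (a + ℓ)) (f a)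
  nlinarith [mul_le_mul_of_nonneg_right hlow hℓ.le]

/-- A function that is uniformly small on `[0,t]` but whose derivative is large somewhere cannot
have a small Hölder constant for its derivative. -/
lemma not_holder_of_small_of_large_deriv {t α ε s₀ : ℝ} {f f' : ℝ → ℝ} (ht : 0 < t) (hα : 0 < α)
    (hε : 0 < ε) (hεt : ε < (t / 4) ^ (2 * (1 + α) / (2 + α)))
    (hf : ∀ s ∈ Icc (0 : ℝ) t, HasDerivWithinAt f (f' s) (Icc (0 : ℝ) t) s)
    (hfε : ∀ s ∈ Icc (0 : ℝ) t, |f s| ≤ ε)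
    (hs₀ : s₀ ∈ Icc (0 : ℝ) t) (hM : ε ^ (α / (2 * (1 + α))) ≤ |f' s₀|) :
    ¬ ∀ s ∈ Icc (0 : ℝ) t, ∀ r ∈ Icc (0 : ℝ) t,
      |f' s - f' r| ≤ (4 ^ (-(1 + α)) * ε ^ (-(α / 2))) * |s - r| ^ α := by
  intro hf'
  set γ : ℝ := (2 + α) / (2 * (1 + α)) with hγ
  have hℓt : 4 * ε ^ γ < t := by
    have h : ε ^ γ < t / 4 := by
      have h := Real.rpow_lt_rpow hε.le hεt (show 0 < γ by positivity)
      rwa [← Real.rpow_mul (by positivity), hγ,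
        show 2 * (1 + α) / (2 + α) * ((2 + α) / (2 * (1 + α))) = 1 by field_simp,
        Real.rpow_one] at h
    linarith
  have key := sub_holder_mul_le_two_mul hα (by positivity) hf hfε hf' hs₀ hM
    (show 0 < 4 * ε ^ γ by positivity) hℓt.le
  have hK : 4 ^ (-(1 + α)) * ε ^ (-(α / 2)) * (4 * ε ^ γ) ^ α
      = 1 / 4 * ε ^ (α / (2 * (1 + α))) := by
    rw [Real.mul_rpow (by norm_num) (by positivity), ← Real.rpow_mul hε.le]
    calc _ = ((4 : ℝ) ^ (-(1 + α)) * 4 ^ α) * (ε ^ (-(α / 2)) * ε ^ (γ * α)) := by ring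
      _ = _ := by
        rw [← Real.rpow_add (by norm_num), ← Real.rpow_add hε,
          show -(1 + α) + α = -1 by ring, Real.rpow_neg_one, hγ,
          show -(α / 2) + (2 + α) / (2 * (1 + α)) * α = α / (2 * (1 + α)) by field_simp; ring]
        norm_num
  have hprod : ε ^ (α / (2 * (1 + α))) * ε ^ γ = ε := by
    rw [← Real.rpow_add hε, hγ,
      show α / (2 * (1 + α)) + (2 + α) / (2 * (1 + α)) = 1 by field_simp; ring, Real.rpow_one]
  rw [hK] at key
  nlinarith

lemma continuousOn_of_holder {S : Set ℝ} {α C : ℝ} {f : ℝ → ℝ} (hα : 0 < α)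
    (hf : ∀ s ∈ S, ∀ r ∈ S, |f s - f r| ≤ C * |s - r| ^ α) : ContinuousOn f S := by
  intro r hr
  refine tendsto_iff_dist_tendsto_zero.2 (squeeze_zero' (Eventually.of_forall fun _ => dist_nonneg)
    (eventually_nhdsWithin_of_forall fun s hs => (Real.dist_eq _ _).trans_le (hf s hs r hr)) ?_)
  have h : Continuous fun s : ℝ => C * |s - r| ^ α :=
    continuous_const.mul ((by fun_prop : Continuous fun s : ℝ => |s - r|).rpow_const
      fun _ => Or.inr hα.le)
  simpa [Real.zero_rpow hα.ne'] using (h.tendsto r).mono_left nhdsWithin_le_nhds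

lemma holder_of_denseRange {X ι : Type*} [TopologicalSpace X] {e : ι → X} (he : DenseRange e)
    {u : X → ℝ} (hu : Continuous u) {f : X → ℝ} (hf : Continuous f) {α K : ℝ} (hα : 0 < α)
    (h : ∀ i j, |f (e i) - f (e j)| ≤ K * |u (e i) - u (e j)| ^ α) (x y : X) :
    |f x - f y| ≤ K * |u x - u y| ^ α := by
  refine he.induction_on₂ (p := fun x y => |f x - f y| ≤ K * |u x - u y| ^ α) ?_ h x y
  refine isClosed_le (by fun_prop) (continuous_const.mul ?_)
  exact (by fun_prop : Continuous fun p : X × X => |u p.1 - u p.2|).rpow_const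
    fun _ => Or.inr hα.le

lemma abs_le_supNormIcc {t s : ℝ} {f : ℝ → ℝ} (hf : ContinuousOn f (Icc 0 t))
    (hs : s ∈ Icc (0 : ℝ) t) : |f s| ≤ supNormIcc t f := by
  have hbdd : BddAbove (range fun s : Icc (0 : ℝ) t => |f s|) := by
    simpa only [image_eq_range] using (isCompact_Icc.image_of_continuousOn hf.abs).bddAbove
  exact le_ciSup hbdd ⟨s, hs⟩

lemma exists_supNormIcc_le {t : ℝ} {f : ℝ → ℝ} (ht : 0 ≤ t) (hf : ContinuousOn f (Icc 0 t)) :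
    ∃ s ∈ Icc (0 : ℝ) t, supNormIcc t f ≤ |f s| := by
  have hne : (Icc (0 : ℝ) t).Nonempty := nonempty_Icc.2 ht
  obtain ⟨s, hs, hmax⟩ := isCompact_Icc.exists_isMaxOn hne hf.abs
  have := hne.to_subtype
  exact ⟨s, hs, ciSup_le fun r => hmax r.2⟩

lemma supNormIcc_nonneg (t : ℝ) (f : ℝ → ℝ) : 0 ≤ supNormIcc t f :=
  Real.iSup_nonneg fun _ => abs_nonneg _

lemma div_le_holderSeminormIcc {t α C : ℝ} {f : ℝ → ℝ}
    (hf : ∀ s ∈ Icc (0 : ℝ) t, ∀ r ∈ Icc (0 : ℝ) t, |f s - f r| ≤ C * |s - r| ^ α)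
    (s r : Icc (0 : ℝ) t) :
    |f s - f r| / |(s : ℝ) - r| ^ α ≤ holderSeminormIcc t α f := by
  refine le_ciSup (f := fun p : Icc (0 : ℝ) t × Icc (0 : ℝ) t =>
    |f p.1 - f p.2| / |(p.1 : ℝ) - (p.2 : ℝ)| ^ α) ⟨max C 0, ?_⟩ (s, r)
  rintro _ ⟨p, rfl⟩
  refine div_le_of_le_mul₀ (by positivity) (le_max_right _ _)
    ((hf _ p.1.2 _ p.2.2).trans ?_)
  gcongr
  exact le_max_left _ _

/-- The derivative at a fixed time of a measurable random function is a.e. measurable. -/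
lemma aemeasurable_of_hasDerivWithinAt {Ω : Type*} [MeasurableSpace Ω] {μ : Measure Ω}
    {S : Set ℝ} {s : ℝ} (hs : AccPt s (𝓟 S)) {g : Ω → ℝ → ℝ} {d : Ω → ℝ}
    (hg : Measurable (Function.uncurry g)) (hd : ∀ᵐ ω ∂μ, HasDerivWithinAt (g ω) (d ω) S s) :
    AEMeasurable d μ := by
  have : (𝓝[S \ {s}] s).NeBot := by
    rwa [accPt_principal_iff_nhdsWithin] at hs
  refine aemeasurable_of_tendsto_metrizable_ae (𝓝[S \ {s}] s)
    (f := fun r ω => slope (g ω) s r) (fun r => ?_) ?_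
  · have h (x : ℝ) : Measurable fun ω => g ω x := hg.comp (measurable_id.prodMk measurable_const)
    simp only [slope_def_field]
    exact (((h r).sub (h s)).div_const _).aemeasurable
  · filter_upwards [hd] with ω hω using hasDerivWithinAt_iff_tendsto_slope.1 hω

/-- A countable family `g φ` of random `C^{1,α}` functions on `[0,t]`: the probability that
for some `φ` one has `‖g_φ‖_{L^∞} ≤ ε` while `‖g_φ'‖_{L^∞} ≥ ε^{α/(2(1+α))}` is bounded by
`4^{2q(1+α)/α} ε^q E(sup_φ ‖g_φ‖_{C^{1,α}}^{2q/α})`, for all `ε < ε₀ = (t/4)^{2(1+α)/(2+α)}`. -/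
theorem prob_small_sup_large_deriv_le
    {Ω : Type*} [MeasureSpace Ω] [IsProbabilityMeasure (volume : Measure Ω)]
    {T : Type*} [Countable T]
    (t α q : ℝ) (ht : 0 < t) (hα0 : 0 < α) (hα1 : α ≤ 1) (hq : 1 ≤ q)
    (g g' : T → Ω → ℝ → ℝ)
    (hmeas : ∀ φ : T, Measurable (Function.uncurry (g φ)))
    (hC1α : ∀ᵐ ω ∂(volume : Measure Ω), ∀ φ : T,
      (∀ s ∈ Icc (0 : ℝ) t, HasDerivWithinAt (g φ ω) (g' φ ω s) (Icc (0 : ℝ) t) s) ∧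
      ∃ C : ℝ, ∀ s ∈ Icc (0 : ℝ) t, ∀ r ∈ Icc (0 : ℝ) t,
        |g' φ ω s - g' φ ω r| ≤ C * |s - r| ^ α) :
    ∀ ε : ℝ, 0 < ε → ε < (t / 4) ^ (2 * (1 + α) / (2 + α)) →
      volume {ω : Ω | ∃ φ : T, supNormIcc t (g φ ω) ≤ ε ∧
          ε ^ (α / (2 * (1 + α))) ≤ supNormIcc t (g' φ ω)} ≤
        ENNReal.ofReal (4 ^ (2 * q * (1 + α) / α) * ε ^ q) *
          ∫⁻ ω, ⨆ φ : T, ENNReal.ofReal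
            ((supNormIcc t (g φ ω) + supNormIcc t (g' φ ω) +
              holderSeminormIcc t α (g' φ ω)) ^ (2 * q / α)) := by
  intro ε hε hεt
  have : Nonempty (Icc (0 : ℝ) t) := ⟨⟨0, le_rfl, ht.le⟩⟩
  set e : ℕ → Icc (0 : ℝ) t := TopologicalSpace.denseSeq (Icc (0 : ℝ) t)
  have he : DenseRange e := TopologicalSpace.denseRange_denseSeq _
  set K : ℝ := 4 ^ (-(1 + α)) * ε ^ (-(α / 2)) with hK
  have hKpos : 0 < K := by positivity
  have hp : 0 < 2 * q / α := by positivity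
  let R : T → Ω → ℕ × ℕ → ℝ := fun φ ω p =>
    |g' φ ω (e p.1) - g' φ ω (e p.2)| / |(e p.1 : ℝ) - e p.2| ^ α
  let F : Ω → ℝ≥0∞ := fun ω => ⨆ φ : T, ⨆ p : ℕ × ℕ, ENNReal.ofReal (R φ ω p ^ (2 * q / α))
  have hF : AEMeasurable F volume := by
    have hder (φ : T) (s : Icc (0 : ℝ) t) : AEMeasurable (fun ω => g' φ ω s) volume :=
      aemeasurable_of_hasDerivWithinAt (uniqueDiffOn_Icc ht s s.2).accPt (hmeas φ)
        (hC1α.mono fun ω hω => (hω φ).1 s s.2)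
    refine AEMeasurable.iSup fun φ => AEMeasurable.iSup fun p => ?_
    have h1 : AEMeasurable (fun ω => g' φ ω (e p.1) - g' φ ω (e p.2)) volume :=
      (hder φ (e p.1)).sub (hder φ (e p.2))
    have h2 : AEMeasurable (fun ω => |g' φ ω (e p.1) - g' φ ω (e p.2)|) volume := h1.norm
    exact ((h2.div_const _).pow_const _).ennreal_ofReal
  have hFle : ∀ᵐ ω ∂(volume : Measure Ω), F ω ≤ ⨆ φ : T, ENNReal.ofReal
      ((supNormIcc t (g φ ω) + supNormIcc t (g' φ ω) +
        holderSeminormIcc t α (g' φ ω)) ^ (2 * q / α)) := by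
    filter_upwards [hC1α] with ω hω
    refine iSup_mono fun φ => iSup_le fun p => ENNReal.ofReal_le_ofReal ?_
    obtain ⟨-, C, hC⟩ := hω φ
    have h := div_le_holderSeminormIcc hC (e p.1) (e p.2)
    refine Real.rpow_le_rpow (by positivity) ?_ hp.le
    linarith [supNormIcc_nonneg t (g φ ω), supNormIcc_nonneg t (g' φ ω)]
  have hevent : ∀ᵐ ω ∂(volume : Measure Ω),
      ω ∈ {ω : Ω | ∃ φ : T, supNormIcc t (g φ ω) ≤ ε ∧
          ε ^ (α / (2 * (1 + α))) ≤ supNormIcc t (g' φ ω)} →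
        ω ∈ {ω : Ω | ENNReal.ofReal (K ^ (2 * q / α)) ≤ F ω} := by
    filter_upwards [hC1α] with ω hω ⟨φ, hsmall, hlarge⟩
    obtain ⟨hd, C, hC⟩ := hω φ
    have hcont' : ContinuousOn (g' φ ω) (Icc 0 t) := continuousOn_of_holder hα0 hC
    obtain ⟨s₀, hs₀, hM⟩ := exists_supNormIcc_le ht.le hcont'
    by_contra hlt
    rw [not_le] at hlt
    refine not_holder_of_small_of_large_deriv ht hα0 hε hεt hd
      (fun s hs => (abs_le_supNormIcc (fun r hr => (hd r hr).continuousWithinAt) hs).trans hsmall)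
      hs₀ (hlarge.trans hM) fun s hs r hr => ?_
    refine holder_of_denseRange he continuous_subtype_val (f := fun x => g' φ ω x)
      (continuousOn_iff_continuous_domRestrict.1 hcont') hα0 (fun i j => ?_) ⟨s, hs⟩ ⟨r, hr⟩
    have hle : ENNReal.ofReal (R φ ω (i, j) ^ (2 * q / α)) < ENNReal.ofReal (K ^ (2 * q / α)) :=
      ((le_iSup (fun p => ENNReal.ofReal (R φ ω p ^ (2 * q / α))) (i, j)).trans
        (le_iSup (fun φ => ⨆ p, ENNReal.ofReal (R φ ω p ^ (2 * q / α))) φ)).trans_lt hlt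
    have hRK : R φ ω (i, j) < K :=
      (Real.rpow_lt_rpow_iff (by positivity) hKpos.le hp).1
        ((ENNReal.ofReal_lt_ofReal_iff (by positivity)).1 hle)
    rcases eq_or_ne (e i) (e j) with hij | hij
    · simp [hij, Real.zero_rpow hα0.ne']
    · have hpos : 0 < |(e i : ℝ) - e j| ^ α :=
        Real.rpow_pos_of_pos (abs_pos.2 (sub_ne_zero.2 (Subtype.coe_injective.ne hij))) _
      exact ((div_lt_iff₀ hpos).1 hRK).le
  have hconst : (4 : ℝ) ^ (2 * q * (1 + α) / α) * ε ^ q * K ^ (2 * q / α) = 1 := by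
    rw [hK, Real.mul_rpow (by positivity) (by positivity), ← Real.rpow_mul (by norm_num),
      ← Real.rpow_mul hε.le, mul_mul_mul_comm, ← Real.rpow_add (by norm_num), ← Real.rpow_add hε,
      show 2 * q * (1 + α) / α + -(1 + α) * (2 * q / α) = 0 by ring,
      show q + -(α / 2) * (2 * q / α) = 0 by field_simp; ring]
    simp
  calc _ ≤ volume {ω : Ω | ENNReal.ofReal (K ^ (2 * q / α)) ≤ F ω} := measure_mono_ae hevent
    _ = ENNReal.ofReal (4 ^ (2 * q * (1 + α) / α) * ε ^ q) * (ENNReal.ofReal (K ^ (2 * q / α)) *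
          volume {ω : Ω | ENNReal.ofReal (K ^ (2 * q / α)) ≤ F ω}) := by
        rw [← mul_assoc, ← ENNReal.ofReal_mul (by positivity), hconst, ENNReal.ofReal_one, one_mul]
    _ ≤ _ := by
        gcongr
        exact (mul_meas_ge_le_lintegral₀ hF _).trans (lintegral_mono_ae hFle)
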